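/- arXiv:1604.04084 — 2 statements merged into one kernel-verified Lean document; each statement's English description precedes it below -/
import Mathlib

section
/- There exists an element σ of the subgroup N = ⟨x, y⟩ of 𝒢 such that t_{14} t_6 t_3 t_{11} = σ · t_5 t_3 t_8 t_{14}. -/
/-!
Symmetric generation of `M₂₂` (Hasan–Lim).  `G` is the quotient of the free
group on three generators `x, y, t` by the normal closure of the relators
`x^7, y^2, (xy)^3, [x,y]^4, t^2, [t^{x^2}, y x⁻¹], [t, y],
 (y t^{x^2})^5, (x y x^2 t^x)^5, (x t)^8`,
where `a ^ b := b⁻¹ a b` and `[a, b] := a⁻¹ b⁻¹ a b`.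
-/

namespace M22

abbrev F := FreeGroup (Fin 3)
def fx : F := FreeGroup.of 0
def fy : F := FreeGroup.of 1
def ft : F := FreeGroup.of 2

/-- conjugation `a ^ b = b⁻¹ * a * b` -/
def fconj (a b : F) : F := b⁻¹ * a * b
/-- commutator `[a, b] = a⁻¹ * b⁻¹ * a * b` -/
def fcomm (a b : F) : F := a⁻¹ * b⁻¹ * a * b

def rels : Set F :=
  {fx ^ 7, fy ^ 2, (fx * fy) ^ 3, (fcomm fx fy) ^ 4, ft ^ 2,
   fcomm (fconj ft (fx ^ 2)) (fy * fx⁻¹), fcomm ft fy,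
   (fy * fconj ft (fx ^ 2)) ^ 5, (fx * fy * fx ^ 2 * fconj ft fx) ^ 5,
   (fx * ft) ^ 8}

abbrev G := PresentedGroup rels

def x : G := PresentedGroup.of 0
def y : G := PresentedGroup.of 1
def t : G := PresentedGroup.of 2

/-- The symmetric generators `t₁, …, t₁₄`: for `1 ≤ i ≤ 7`, `tᵢ = t ^ (xⁱ)`,
and for `1 ≤ k ≤ 7`, `t₍₇₊ₖ₎ = t ^ (x⁵ y x^(k-1))`; the index is read modulo
`14` with representatives `1, …, 14`. -/
def tt (i : ℕ) : G :=
  let j := (i - 1) % 14 + 1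
  if j ≤ 7 then (x ^ j)⁻¹ * t * x ^ j
  else (x ^ 5 * y * x ^ (j - 8))⁻¹ * t * (x ^ 5 * y * x ^ (j - 8))

/-- the control subgroup `N = ⟨x, y⟩` of `G` -/
def N : Subgroup G := Subgroup.closure {x, y}


/-! ### Words in `x, x⁻¹, y` (coded `0, 1, 2`) and their values -/

def lx : ℕ → G
  | 0 => x
  | 1 => x⁻¹
  | _ => y

def il : ℕ → ℕ
  | 0 => 1
  | 1 => 0
  | n + 2 => n + 2

def ev (w : List ℕ) : G := (w.map lx).prod
def invw (w : List ℕ) : List ℕ := (w.map il).reverse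

lemma mk_rel {r : F} (h : r ∈ rels) : PresentedGroup.mk rels r = 1 :=
  PresentedGroup.one_of_mem h

lemma x7 : x ^ 7 = 1 := mk_rel (r := fx ^ 7) (by simp [rels])
lemma y2 : y ^ 2 = 1 := mk_rel (r := fy ^ 2) (by simp [rels])
lemma xy3 : (x * y) ^ 3 = 1 := mk_rel (r := (fx * fy) ^ 3) (by simp [rels])
lemma xy4 : (x⁻¹ * y⁻¹ * x * y) ^ 4 = 1 := mk_rel (r := (fcomm fx fy) ^ 4) (by simp [rels])
lemma t2 : t ^ 2 = 1 := mk_rel (r := ft ^ 2) (by simp [rels])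
lemma rty : t⁻¹ * y⁻¹ * t * y = 1 := mk_rel (r := fcomm ft fy) (by simp [rels])
lemma rtx : ((x ^ 2)⁻¹ * t * x ^ 2)⁻¹ * (y * x⁻¹)⁻¹ * ((x ^ 2)⁻¹ * t * x ^ 2) * (y * x⁻¹) = 1 :=
  mk_rel (r := fcomm (fconj ft (fx ^ 2)) (fy * fx⁻¹)) (by simp [rels])
lemma r5 : (y * ((x ^ 2)⁻¹ * t * x ^ 2)) ^ 5 = 1 :=
  mk_rel (r := (fy * fconj ft (fx ^ 2)) ^ 5) (by simp [rels])
lemma r5' : (x * y * x ^ 2 * (x⁻¹ * t * x)) ^ 5 = 1 :=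
  mk_rel (r := (fx * fy * fx ^ 2 * fconj ft fx) ^ 5) (by simp [rels])
lemma r8 : (x * t) ^ 8 = 1 := mk_rel (r := (fx * ft) ^ 8) (by simp [rels])

lemma yy : y * y = 1 := by rw [← pow_two, y2]
lemma yinv : y⁻¹ = y := inv_eq_of_mul_eq_one_left yy
lemma tt1 : t * t = 1 := by rw [← pow_two, t2]

lemma lx_il (a : ℕ) : lx (il a) = (lx a)⁻¹ := by
  match a with
  | 0 => rfl
  | 1 => simp [il, lx]
  | n + 2 => simp [il, lx, yinv]

@[simp] lemma ev_nil : ev [] = 1 := rfl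
@[simp] lemma ev_cons (a : ℕ) (w : List ℕ) : ev (a :: w) = lx a * ev w := by simp [ev]
@[simp] lemma ev_append (v w : List ℕ) : ev (v ++ w) = ev v * ev w := by simp [ev]

@[simp] lemma ev_invw (w : List ℕ) : ev (invw w) = (ev w)⁻¹ := by
  induction w with
  | nil => simp [invw]
  | cons a w ih =>
    have : invw (a :: w) = invw w ++ [il a] := by simp [invw]
    rw [this]; simp [ih, lx_il]

lemma ev_mem (w : List ℕ) : ev w ∈ N := by
  have hx : x ∈ N := Subgroup.subset_closure (by simp)
  have hy : y ∈ N := Subgroup.subset_closure (by simp)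
  induction w with
  | nil => exact N.one_mem
  | cons a w ih =>
    rw [ev_cons]
    refine N.mul_mem ?_ ih
    match a with
    | 0 => exact hx
    | 1 => exact N.inv_mem hx
    | n + 2 => exact hy

/-- put a letter in front of a freely reduced word -/
def rcons (a : ℕ) : List ℕ → List ℕ
  | [] => [a]
  | b :: v => if il a = b then v else a :: b :: v

def red2 (w : List ℕ) : List ℕ := w.foldr rcons []

lemma ev_rcons (a : ℕ) (w : List ℕ) : ev (rcons a w) = lx a * ev w := by
  cases w with
  | nil => simp [rcons]
  | cons b v =>
    by_cases h : il a = b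
    · subst h; simp [rcons, lx_il]
    · simp [rcons, h]

lemma ev_red2 (w : List ℕ) : ev (red2 w) = ev w := by
  induction w with
  | nil => rfl
  | cons a w ih =>
    change ev (rcons a (red2 w)) = _
    rw [ev_rcons, ih, ev_cons]

/-- the relators of `N` -/
def relN : ℕ → List ℕ
  | 0 => [0, 0, 0, 0, 0, 0, 0]
  | 1 => [0, 2, 0, 2, 0, 2]
  | _ => [1, 2, 0, 2, 1, 2, 0, 2, 1, 2, 0, 2, 1, 2, 0, 2]

lemma ev_relN (b : ℕ) : ev (relN b) = 1 := by
  match b with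
  | 0 => simpa [relN, lx, pow_succ, mul_assoc] using x7
  | 1 => simpa [relN, lx, pow_succ, mul_assoc] using xy3
  | n + 2 => simpa [relN, lx, pow_succ, mul_assoc, yinv] using xy4

def rot2 (n : ℕ) (w : List ℕ) : List ℕ := w.drop n ++ w.take n

lemma ev_rot2 (n : ℕ) (w : List ℕ) (h : ev w = 1) : ev (rot2 n w) = 1 := by
  have h1 : ev (w.take n) * ev (w.drop n) = 1 := by
    rw [← ev_append, List.take_append_drop, h]
  rw [rot2, ev_append]
  exact mul_eq_one_iff_eq_inv.mpr (eq_inv_of_mul_eq_one_right h1)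

/-- the conjugate of `t` by a word -/
def Q (w : List ℕ) : G := (ev w)⁻¹ * t * ev w

/-- insertion of a relator in a word (or of a prefix centralizing `t`),
followed by free reduction; steps are coded `(position, relator, inverted?, rotation)` -/
def step2 (w : List ℕ) (s : ℕ × ℕ × Bool × ℕ) : List ℕ :=
  match s with
  | (i, b, d, r) =>
    if b = 10 then red2 (2 :: w)
    else if b = 11 then red2 ([0, 0, 0, 2, 1, 1] ++ w)
    else if b = 12 then red2 ([0, 0, 2, 1, 1, 1] ++ w)
    else red2 (w.take i ++
      (invw (rot2 r (if d then invw (relN b) else relN b)) ++ w.drop i))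

lemma Q_pre (u w : List ℕ) (h : Commute t (ev u)) : Q (u ++ w) = Q w := by
  have h' : (ev u)⁻¹ * t * ev u = t := by
    rw [mul_assoc, h.eq, inv_mul_cancel_left]
  calc Q (u ++ w) = (ev w)⁻¹ * ((ev u)⁻¹ * t * ev u) * ev w := by
        simp [Q, mul_assoc]
    _ = Q w := by rw [h']; rfl

lemma comm_y : Commute t y := by
  have h := rty
  have h2 : t⁻¹ * y⁻¹ * t * y = (y * t)⁻¹ * (t * y) := by group
  rw [h2, inv_mul_eq_one] at h
  exact h.symm

lemma comm_h : Commute t (x ^ 2 * (y * x⁻¹) * (x ^ 2)⁻¹) := by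
  have h := rtx
  have h2 : ∀ a b c : G, (a⁻¹ * c * a)⁻¹ * b⁻¹ * (a⁻¹ * c * a) * b
      = a⁻¹ * ((a * b * a⁻¹ * c)⁻¹ * (c * (a * b * a⁻¹))) * a := by
    intro a b c; group
  rw [h2] at h
  have h3 : (x ^ 2 * (y * x⁻¹) * (x ^ 2)⁻¹ * t)⁻¹ * (t * (x ^ 2 * (y * x⁻¹) * (x ^ 2)⁻¹)) = 1 := by
    have := congrArg (fun g => x ^ 2 * g * (x ^ 2)⁻¹) h
    simpa [mul_assoc] using this
  rw [inv_mul_eq_one] at h3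
  exact h3.symm

lemma Q_step2 (w : List ℕ) (s : ℕ × ℕ × Bool × ℕ) : Q (step2 w s) = Q w := by
  obtain ⟨i, b, d, r⟩ := s
  have hQ : ∀ v, Q (red2 v) = Q v := fun v => by simp [Q, ev_red2]
  unfold step2
  dsimp only
  by_cases h1 : b = 10
  · rw [if_pos h1, hQ]
    exact Q_pre [2] w (by simpa [lx] using comm_y)
  rw [if_neg h1]
  by_cases h2 : b = 11
  · rw [if_pos h2, hQ]
    refine Q_pre _ w ?_
    have := comm_h.inv_right
    simpa [lx, pow_two, mul_assoc, yinv] using this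
  rw [if_neg h2]
  by_cases h3 : b = 12
  · rw [if_pos h3, hQ]
    refine Q_pre _ w ?_
    simpa [lx, pow_two, mul_assoc] using comm_h
  · rw [if_neg h3, hQ]
    have h : ev (invw (rot2 r (if d then invw (relN b) else relN b))) = 1 := by
      rw [ev_invw, ev_rot2 _ _ (by split_ifs <;> simp [ev_relN]), inv_one]
    have : ev (w.take i ++
      (invw (rot2 r (if d then invw (relN b) else relN b)) ++ w.drop i)) = ev w := by
      rw [ev_append, ev_append, h, one_mul, ← ev_append, List.take_append_drop]
    simp only [Q, this]

lemma Q_steps (S : List (ℕ × ℕ × Bool × ℕ)) (w : List ℕ) : Q (S.foldl step2 w) = Q w := by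
  induction S generalizing w with
  | nil => rfl
  | cons s S ih => rw [List.foldl_cons, ih, Q_step2]

lemma Q_eq {w v : List ℕ} (S : List (ℕ × ℕ × Bool × ℕ)) (h : S.foldl step2 w = v) :
    Q w = Q v := by rw [← h, Q_steps]

/-! ### The symmetric generators and the action of `N` on them -/

/-- coset representatives: `tᵢ = t ^ rep i` (out of range: `t₇`) -/
def rep (i : ℕ) : List ℕ :=
  if 1 ≤ i ∧ i ≤ 7 then List.replicate i 0
  else if 8 ≤ i ∧ i ≤ 14 then [0, 0, 0, 0, 0, 2] ++ List.replicate (i - 8) 0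
  else []

def T (i : ℕ) : G := Q (rep i)

lemma Q_y {w v : List ℕ} (S : List (ℕ × ℕ × Bool × ℕ))
    (h : S.foldl step2 (red2 (w ++ [2])) = v) : Q w * y = y * Q v := by
  rw [← h, Q_steps]
  simp [Q, ev_red2, lx, mul_assoc]

lemma Q_y' {w v : List ℕ} (h : Q w * y = y * Q v) : Q v * y = y * Q w := by
  have h2 : Q v = y * (Q w * y) := by rw [h, ← mul_assoc, yy, one_mul]
  rw [h2, mul_assoc, mul_assoc, yy, mul_one]

lemma Q_x {w v : List ℕ} (S : List (ℕ × ℕ × Bool × ℕ))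
    (h : S.foldl step2 (red2 (w ++ [0])) = v) : Q w * x = x * Q v := by
  rw [← h, Q_steps]
  simp [Q, ev_red2, lx, mul_assoc]

def ax (i : ℕ) : ℕ := [1, 2, 3, 4, 5, 6, 7, 1, 9, 10, 11, 12, 13, 14, 8].getD i 1
def aX (i : ℕ) : ℕ := [6, 7, 1, 2, 3, 4, 5, 6, 14, 8, 9, 10, 11, 12, 13].getD i 6
def ay (i : ℕ) : ℕ := [7, 12, 3, 2, 11, 8, 13, 7, 5, 10, 9, 4, 1, 6, 14].getD i 7

lemma rep_big (i : ℕ) (h : 15 ≤ i) : rep i = [] := by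
  unfold rep
  rw [if_neg (by omega), if_neg (by omega)]

lemma T_x (i : ℕ) : T i * x = x * T (ax i) := by
  unfold T
  rcases lt_or_ge i 15 with h | h
  · interval_cases i
    all_goals first
      | exact Q_x [] (by decide)
      | exact Q_x [(0, 0, false, 0)] (by decide)
      | exact Q_x [(6, 0, false, 0)] (by decide)
  · have : ax i = 1 := by
      unfold ax; rw [List.getD_eq_default]; simpa using h
    rw [this, rep_big i h]
    exact Q_x [] (by decide)

lemma T_y (i : ℕ) : T i * y = y * T (ay i) := by
  have h0 : Q [] * y = y * Q (rep 7) := Q_y [(0, 10, false, 0), (0, 0, true, 0)] (by decide)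
  have h1 : Q (rep 1) * y = y * Q (rep 12) :=
    Q_y [(0, 1, false, 0), (0, 10, false, 0), (0, 0, true, 0), (0, 12, false, 0), (1, 1, false, 0), (5, 1, false, 0), (0, 2, false, 2), (0, 10, false, 0), (1, 1, true, 0), (0, 11, false, 0), (6, 0, true, 0)]
      (by decide)
  have h2 : Q (rep 2) * y = y * Q (rep 3) :=
    Q_y [(0, 11, false, 0)]
      (by decide)
  have h4 : Q (rep 4) * y = y * Q (rep 11) :=
    Q_y [(0, 1, true, 1), (0, 10, false, 0), (4, 0, false, 0), (5, 1, true, 1), (1, 2, false, 1), (0, 11, false, 0), (0, 11, false, 0), (4, 1, true, 0)]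
      (by decide)
  have h5 : Q (rep 5) * y = y * Q (rep 8) :=
    Q_y []
      (by decide)
  have h6 : Q (rep 6) * y = y * Q (rep 13) :=
    Q_y [(0, 12, false, 0), (1, 1, false, 0), (5, 1, false, 0), (0, 2, false, 2), (0, 10, false, 0), (1, 1, true, 0), (0, 11, false, 0), (6, 0, true, 0)]
      (by decide)
  have h7 : Q (rep 7) * y = y * Q (rep 7) :=
    Q_y [(0, 0, false, 0), (0, 10, false, 0), (0, 0, true, 0)]
      (by decide)
  have h9 : Q (rep 9) * y = y * Q (rep 10) :=
    Q_y [(0, 0, false, 0), (0, 1, true, 1), (0, 10, false, 0), (1, 2, false, 1), (0, 11, false, 0), (0, 11, false, 0), (4, 1, true, 0)]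
      (by decide)
  have h14 : Q (rep 14) * y = y * Q (rep 14) :=
    Q_y [(0, 12, false, 0), (6, 0, false, 0), (1, 1, false, 0), (0, 2, false, 2), (0, 10, false, 0), (1, 1, true, 0), (0, 11, false, 0), (6, 0, true, 0)]
      (by decide)
  unfold T
  rcases lt_or_ge i 15 with h | h
  · interval_cases i
    exacts [h0, h1, h2, Q_y' h2, h4, h5, h6, h7, Q_y' h5, h9, Q_y' h9, Q_y' h4, Q_y' h1,
      Q_y' h6, h14]
  · have : ay i = 7 := by
      unfold ay; rw [List.getD_eq_default]; simpa using h
    rw [this, rep_big i h]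
    exact h0

lemma T_X (i : ℕ) : T i * x⁻¹ = x⁻¹ * T (aX i) := by
  have key : T (ax (aX i)) = T i := by
    rcases lt_or_ge i 15 with h | h
    · interval_cases i
      all_goals first
        | rfl
        | exact (Q_eq [(0, 0, true, 0)] (by decide) : Q (rep 0) = Q (rep 7)).symm
    · have : aX i = 6 := by
        unfold aX; rw [List.getD_eq_default]; simpa using h
      rw [this]
      unfold T
      rw [rep_big i h]
      exact (Q_eq [(0, 0, true, 0)] (by decide) : Q [] = Q (rep 7)).symm
  have h := T_x (aX i)
  rw [key] at h
  rw [mul_inv_eq_iff_eq_mul, mul_assoc, h, inv_mul_cancel_left]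

/-- action of a letter / word on the indices -/
def al : ℕ → ℕ → ℕ
  | 0, i => ax i
  | 1, i => aX i
  | _, i => ay i

def act (w : List ℕ) (i : ℕ) : ℕ := w.foldl (fun j a => al a j) i

lemma T_lx (a i : ℕ) : T i * lx a = lx a * T (al a i) := by
  match a with
  | 0 => exact T_x i
  | 1 => exact T_X i
  | n + 2 => exact T_y i

lemma T_ev (w : List ℕ) (i : ℕ) : T i * ev w = ev w * T (act w i) := by
  induction w generalizing i with
  | nil => simp [act]
  | cons a w ih =>
    have : act (a :: w) i = act w (al a i) := rfl
    rw [ev_cons, this, ← mul_assoc, T_lx, mul_assoc, ih, mul_assoc]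

lemma T_sq (i : ℕ) : T i * T i = 1 := by
  have : T i * T i = (ev (rep i))⁻¹ * (t * t) * ev (rep i) := by
    simp [T, Q, mul_assoc]
  rw [this, tt1]; simp

/-! ### Words in the symmetric generators -/

def pr (p : List ℕ) : G := (p.map T).prod

@[simp] lemma pr_nil : pr [] = 1 := rfl
@[simp] lemma pr_cons (a : ℕ) (w : List ℕ) : pr (a :: w) = T a * pr w := by simp [pr]
@[simp] lemma pr_append (v w : List ℕ) : pr (v ++ w) = pr v * pr w := by simp [pr]

lemma pr_ev (p w : List ℕ) : pr p * ev w = ev w * pr (p.map (act w)) := by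
  induction p with
  | nil => simp
  | cons a p ih => rw [pr_cons, mul_assoc, ih, ← mul_assoc, T_ev]; simp [mul_assoc]

lemma pr_reverse (p : List ℕ) : pr p.reverse = (pr p)⁻¹ := by
  induction p with
  | nil => simp
  | cons a p ih =>
    rw [List.reverse_cons, pr_append, ih, pr_cons a p, mul_inv_rev,
      inv_eq_of_mul_eq_one_left (T_sq a)]
    simp

def tcons (a : ℕ) : List ℕ → List ℕ
  | [] => [a]
  | b :: v => if a = b then v else a :: b :: v

def red (w : List ℕ) : List ℕ := w.foldr tcons []

lemma pr_tcons (a : ℕ) (w : List ℕ) : pr (tcons a w) = T a * pr w := by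
  cases w with
  | nil => simp [tcons]
  | cons b v =>
    by_cases h : a = b
    · subst h; simp [tcons, ← mul_assoc, T_sq]
    · simp [tcons, h]

lemma pr_red (w : List ℕ) : pr (red w) = pr w := by
  induction w with
  | nil => rfl
  | cons a w ih =>
    change pr (tcons a (red w)) = _
    rw [pr_tcons, ih, pr_cons]

/-- A relation `pr R.1 = ev R.2`. -/
def Valid (R : List ℕ × List ℕ) : Prop := pr R.1 = ev R.2

def pw (w p : List ℕ) : ℕ → List ℕ × List ℕ
  | 0 => ([], [])
  | n + 1 => (((pw w p n).1.map (act w)) ++ p, (pw w p n).2 ++ w)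

lemma pw_eq (w p : List ℕ) (n : ℕ) :
    (ev w * pr p) ^ n = ev (pw w p n).2 * pr (pw w p n).1 := by
  induction n with
  | zero => simp [pw]
  | succ n ih =>
    rw [pow_succ, ih]
    simp only [pw, ev_append, pr_append]
    have := pr_ev (pw w p n).1 w
    calc _ = ev (pw w p n).2 * (pr (pw w p n).1 * ev w) * pr p := by simp only [mul_assoc]
      _ = _ := by rw [this]; simp only [mul_assoc]

def relPow (w p : List ℕ) (n : ℕ) : List ℕ × List ℕ := ((pw w p n).1, invw (pw w p n).2)

lemma valid_relPow (w p : List ℕ) (n : ℕ) (h : (ev w * pr p) ^ n = 1) :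
    Valid (relPow w p n) := by
  rw [pw_eq] at h
  unfold Valid relPow
  rw [ev_invw]
  exact eq_inv_of_mul_eq_one_right h

def base : ℕ → List ℕ × List ℕ
  | 0 => relPow [2] [2] 5
  | 1 => relPow [0, 2, 0, 0] [1] 5
  | _ => relPow [0] [7] 8

lemma valid_base (b : ℕ) : Valid (base b) := by
  match b with
  | 0 =>
    apply valid_relPow
    simpa [T, Q, rep, lx, List.replicate, pow_two, mul_assoc] using r5
  | 1 =>
    apply valid_relPow
    simpa [T, Q, rep, lx, List.replicate, pow_two, mul_assoc] using r5'
  | n + 2 =>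
    apply valid_relPow
    have h7 : T 7 = t := by
      have : Q (rep 7) = Q [] := Q_eq [(0, 0, false, 0)] (by decide)
      simpa [T, Q] using this
    simpa [h7, lx] using r8

def invR (R : List ℕ × List ℕ) : List ℕ × List ℕ := (R.1.reverse, invw R.2)

lemma valid_invR {R : List ℕ × List ℕ} (h : Valid R) : Valid (invR R) := by
  unfold Valid invR at *
  rw [pr_reverse, ev_invw, h]

def rotR (R : List ℕ × List ℕ) : List ℕ × List ℕ :=
  match R with
  | ([], s) => ([], s)
  | (a :: p, s) => (p ++ [act s a], s)

lemma valid_rotR {R : List ℕ × List ℕ} (h : Valid R) : Valid (rotR R) := by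
  obtain ⟨p, s⟩ := R
  cases p with
  | nil => exact h
  | cons a p =>
    have h : T a * pr p = ev s := by simpa [Valid] using h
    have h2 : pr p = T a * ev s := by rw [← h, ← mul_assoc, T_sq, one_mul]
    simp only [Valid, rotR, pr_append, pr_cons, pr_nil, mul_one]
    rw [h2, T_ev, mul_assoc, T_sq, mul_one]

def conjR (g : List ℕ) (R : List ℕ × List ℕ) : List ℕ × List ℕ :=
  (R.1.map (act g), invw g ++ (R.2 ++ g))

lemma valid_conjR (g : List ℕ) {R : List ℕ × List ℕ} (h : Valid R) : Valid (conjR g R) := by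
  unfold Valid conjR at *
  have := pr_ev R.1 g
  rw [h] at this
  simp only [ev_append, ev_invw]
  rw [this, inv_mul_cancel_left]

def relOf (b : ℕ) (d : Bool) (k : ℕ) (g : List ℕ) : List ℕ × List ℕ :=
  conjR g (rotR^[k] (if d then invR (base b) else base b))

lemma valid_relOf (b : ℕ) (d : Bool) (k : ℕ) (g : List ℕ) : Valid (relOf b d k g) := by
  apply valid_conjR
  induction k with
  | zero =>
    cases d
    · exact valid_base b
    · exact valid_invR (valid_base b)
  | succ k ih =>
    rw [Function.iterate_succ_apply']
    exact valid_rotR ih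

/-- insert (the reverse of) a relator at position `i`, move the resulting element of `N`
to the left and cancel -/
def ins (R : List ℕ × List ℕ) (i : ℕ) (w : List ℕ) : List ℕ :=
  red ((w.take i).map (act R.2) ++ (R.1.reverse ++ w.drop i))

/-- equality of right cosets of `N` -/
def E (v w : List ℕ) : Prop := ∃ σ ∈ N, pr v = σ * pr w

lemma E_ins {R : List ℕ × List ℕ} (h : Valid R) (i : ℕ) (w : List ℕ) : E w (ins R i w) := by
  refine ⟨ev R.2, ev_mem _, ?_⟩
  have h1 := pr_ev (w.take i) R.2
  have h2 : ev R.2 * pr R.1.reverse = 1 := by rw [pr_reverse, h, mul_inv_cancel]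
  rw [ins, pr_red, pr_append, pr_append, ← mul_assoc, ← h1]
  calc pr w = pr (w.take i) * pr (w.drop i) := by rw [← pr_append, List.take_append_drop]
    _ = pr (w.take i) * (ev R.2 * pr R.1.reverse) * pr (w.drop i) := by rw [h2, mul_one]
    _ = _ := by simp only [mul_assoc]

def step (w : List ℕ) (s : ℕ × Bool × ℕ × List ℕ × ℕ) : List ℕ :=
  match s with
  | (b, d, k, g, i) => ins (relOf b d k g) i w

lemma E_trans {u v w : List ℕ} (h1 : E u v) (h2 : E v w) : E u w := by
  obtain ⟨a, ha, h1⟩ := h1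
  obtain ⟨b, hb, h2⟩ := h2
  exact ⟨a * b, N.mul_mem ha hb, by rw [h1, h2, mul_assoc]⟩

lemma E_steps (S : List (ℕ × Bool × ℕ × List ℕ × ℕ)) (w : List ℕ) : E w (S.foldl step w) := by
  induction S generalizing w with
  | nil => exact ⟨1, N.one_mem, by simp⟩
  | cons s S ih => exact E_trans (E_ins (valid_relOf _ _ _ _) _ _) (ih _)

def path : List (ℕ × Bool × ℕ × List ℕ × ℕ) :=
 [(2, false, 0, [2, 0, 0, 0, 2, 0], 2),
 (0, false, 0, [1, 1, 2, 0, 0], 1),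
 (1, false, 0, [0, 0, 0, 2, 1, 1, 1], 5),
 (0, false, 0, [0, 0, 0, 2, 1, 1, 1, 2], 3),
 (0, false, 0, [1, 1, 2, 0, 0, 0, 2], 5),
 (1, false, 0, [0, 2, 1], 5),
 (1, false, 0, [0, 2, 1], 1),
 (0, false, 0, [1, 1, 2], 4),
 (1, true, 0, [0, 0, 2, 1, 1], 4),
 (1, false, 0, [1, 1, 1], 3),
 (0, false, 0, [0, 0, 2, 1, 1, 1, 2], 3),
 (0, false, 0, [0, 2, 1, 1, 2, 0, 0], 5),
 (1, false, 0, [0, 0, 0, 2, 1, 1, 1], 4),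
 (1, false, 0, [], 4),
 (1, true, 0, [0, 0, 2, 1], 4),
 (0, false, 0, [0, 0, 0, 2], 2),
 (1, false, 1, [0, 0, 0, 2, 0], 4),
 (0, false, 0, [1, 1, 1, 2, 1], 3),
 (0, false, 0, [1, 1, 2], 2),
 (0, false, 0, [1, 1, 1], 1),
 (0, false, 0, [1, 1, 1], 4),
 (1, true, 0, [0, 0, 0, 2, 0, 0], 6),
 (0, false, 0, [1, 2, 0, 0, 2], 5),
 (0, false, 0, [0, 0, 2, 1, 1, 1, 2, 0, 0], 2),
 (1, true, 0, [0, 0], 1)]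

lemma path_eq : path.foldl step [14, 6, 3, 11] = [5, 3, 8, 14] := by decide +kernel

lemma tt_low (i : ℕ) (h1 : 1 ≤ i) (h2 : i ≤ 7) : tt i = T i := by
  interval_cases i <;> simp [tt, T, Q, rep, lx, List.replicate, pow_succ, mul_assoc]

lemma tt_high (i : ℕ) (h1 : 8 ≤ i) (h2 : i ≤ 14) : tt i = T i := by
  interval_cases i <;> simp [tt, T, Q, rep, lx, List.replicate, pow_succ, mul_assoc]

/-- There exists `σ ∈ N = ⟨x, y⟩` with `t₁₄ t₆ t₃ t₁₁ = σ · t₅ t₃ t₈ t₁₄`. -/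
theorem key_lemma :
    ∃ σ ∈ N, tt 14 * tt 6 * tt 3 * tt 11
      = σ * (tt 5 * tt 3 * tt 8 * tt 14) := by
  rw [tt_high 14 (by norm_num) (by norm_num), tt_low 6 (by norm_num) (by norm_num),
    tt_low 3 (by norm_num) (by norm_num), tt_high 11 (by norm_num) (by norm_num),
    tt_low 5 (by norm_num) (by norm_num), tt_high 8 (by norm_num) (by norm_num)]
  have h := E_steps path [14, 6, 3, 11]
  rw [path_eq] at h
  obtain ⟨σ, hσ, h⟩ := h
  refine ⟨σ, hσ, ?_⟩
  simpa [mul_assoc] using h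

end M22
end

section
/- The group 𝒢 is perfect: its commutator subgroup equals the whole group, i.e. commutator 𝒢 = ⊤. -/
/-!
Symmetric generation of `M₂₂` (Hasan–Lim).  `G` is the quotient of the free
group on three generators `x, y, t` by the normal closure of the relators
`x^7, y^2, (xy)^3, [x,y]^4, t^2, [t^{x^2}, y x⁻¹], [t, y],
 (y t^{x^2})^5, (x y x^2 t^x)^5, (x t)^8`,
where `a ^ b := b⁻¹ a b` and `[a, b] := a⁻¹ b⁻¹ a b`.
-/

namespace M22

/-- `G` is perfect: its commutator subgroup is the whole group. -/
theorem G_perfect : commutator G = ⊤ := by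
  let φ : F →* Abelianization G := Abelianization.of.comp (PresentedGroup.mk rels)
  have hr : ∀ r ∈ rels, φ r = 1 := by
    intro r hr
    have h1 : PresentedGroup.mk rels r = 1 := PresentedGroup.one_of_mem hr
    change Abelianization.of (PresentedGroup.mk rels r) = 1
    rw [h1, map_one]
  have h7 : φ fx ^ 7 = 1 := by
    rw [← map_pow]; exact hr _ (by simp [rels])
  have h2 : φ fy ^ 2 = 1 := by
    rw [← map_pow]; exact hr _ (by simp [rels])
  have h3 : (φ fx * φ fy) ^ 3 = 1 := by
    rw [← map_mul, ← map_pow]; exact hr _ (by simp [rels])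
  have ht2 : φ ft ^ 2 = 1 := by
    rw [← map_pow]; exact hr _ (by simp [rels])
  have h5 : φ ((fy * fconj ft (fx ^ 2)) ^ 5) = 1 := hr _ (by simp [rels])
  have hx : φ fx = 1 := by
    have h6 : φ fx ^ 6 = 1 := by
      have e : ((φ fx * φ fy) ^ 3) ^ 2 = φ fx ^ 6 * (φ fy ^ 2) ^ 3 := by
        rw [mul_pow, mul_pow, ← pow_mul, ← pow_mul, ← pow_mul]
      rw [h3, h2] at e
      simpa using e.symm
    have := h7
    rw [pow_succ, h6, one_mul] at this
    exact this
  have hy : φ fy = 1 := by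
    rw [hx, one_mul, pow_succ, h2, one_mul] at h3
    exact h3
  have ht : φ ft = 1 := by
    simp only [fconj, map_pow, map_mul, map_inv, hx, hy, one_pow, inv_one, one_mul, mul_one] at h5
    have e : φ ft ^ 5 = (φ ft ^ 2) ^ 2 * φ ft := by rw [← pow_mul, ← pow_succ]
    rw [e, ht2, one_pow, one_mul] at h5
    exact h5
  have hφ : φ = 1 := by
    apply FreeGroup.ext_hom
    intro i
    fin_cases i
    · exact hx
    · exact hy
    · exact ht
  rw [eq_top_iff]
  intro g _
  obtain ⟨w, rfl⟩ := PresentedGroup.mk_surjective rels g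
  have hw : φ w = 1 := by rw [hφ]; rfl
  rw [← Abelianization.ker_of, MonoidHom.mem_ker]
  exact hw

end M22
end
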